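/- arXiv:1710.02092 — 3 statements merged into one kernel-verified Lean document; each statement's English description precedes it below -/
import Mathlib

section
/- For every binary string τ there is a computable function G mapping finite sequences of positive integers to finite sequences of binary strings such that, whenever L = ⟨ℓ_0, …, ℓ_{t−1}⟩ satisfies ∑_{i<t} 2^{−ℓ_i} ≤ 2^{−|τ|}: (i) G(L) = ⟨σ_0, …, σ_{t−1}⟩ is a solution to L as a KC-sequence relative to τ; (ii) G(⟨ℓ_0, …, ℓ_{s−1}⟩) is an initial segment of G(L) for every s ≤ t; and (iii) for every natural number ℓ, there exists an extension of τ of length ℓ which is incomparable with each of σ_0, …, σ_{t−1} if and only if ∑_{i<t} 2^{−ℓ_i} ≤ 2^{−|τ|} − 2^{−ℓ}. -/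
abbrev BStr := List Bool

/-- A set of binary strings is prefix-free if no element is a proper prefix of another. -/
def PrefixFreeSet (S : Set BStr) : Prop :=
  ∀ σ ∈ S, ∀ τ ∈ S, σ <+: τ → σ = τ

/-- The weight `∑_{i<|L|} 2^{-ℓ_i}` of a finite KC-sequence, as a real number. -/
noncomputable def kcWeight (L : List ℕ) : ℝ := (L.map fun l => ((2 : ℝ) ^ l)⁻¹).sum

section KraftWeight

lemma kcWeight_nil : kcWeight [] = 0 := by simp [kcWeight]

lemma kcWeight_cons (l : ℕ) (L : List ℕ) :
    kcWeight (l :: L) = ((2 : ℝ) ^ l)⁻¹ + kcWeight L := by simp [kcWeight]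

lemma kcWeight_append (L M : List ℕ) : kcWeight (L ++ M) = kcWeight L + kcWeight M := by
  simp [kcWeight]

lemma kcWeight_perm {L M : List ℕ} (h : L.Perm M) : kcWeight L = kcWeight M :=
  (h.map _).sum_eq

lemma inv_two_pow_succ (n : ℕ) :
    ((2 : ℝ) ^ (n + 1))⁻¹ + ((2 : ℝ) ^ (n + 1))⁻¹ = ((2 : ℝ) ^ n)⁻¹ := by
  rw [pow_succ, mul_inv]; ring

lemma kcWeight_le_of_pairwise_gt {m : ℕ} (L : List ℕ) :
    ∀ n, m ≤ n → L.Pairwise (· > ·) → (∀ l ∈ L, m < l ∧ l ≤ n) →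
      kcWeight L ≤ ((2 : ℝ) ^ m)⁻¹ - ((2 : ℝ) ^ n)⁻¹ := by
  induction L with
  | nil =>
    intro n hmn _ _
    rw [kcWeight_nil, sub_nonneg]
    gcongr
    norm_num
  | cons a L ih =>
    intro n hmn hp hL
    obtain ⟨hma, han⟩ := hL a (by simp)
    obtain ⟨b, rfl⟩ : ∃ b, a = b + 1 := ⟨a - 1, by omega⟩
    rw [List.pairwise_cons] at hp
    have h := ih b (by omega) hp.2 fun l hl =>
      ⟨(hL l (by simp [hl])).1, by have := hp.1 l hl; omega⟩
    have h2 : ((2 : ℝ) ^ n)⁻¹ ≤ ((2 : ℝ) ^ (b + 1))⁻¹ := by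
      gcongr
      norm_num
    rw [kcWeight_cons]
    linarith [inv_two_pow_succ b]

lemma kcWeight_lt_of_pairwise_gt {m : ℕ} {L : List ℕ} (hp : L.Pairwise (· > ·))
    (hL : ∀ l ∈ L, m < l) : kcWeight L < ((2 : ℝ) ^ m)⁻¹ := by
  have h := kcWeight_le_of_pairwise_gt (m := m) L (m + L.sum) (by omega) hp fun l hl =>
    ⟨hL l hl, (List.le_sum_of_mem hl).trans (by omega)⟩
  have : (0 : ℝ) < ((2 : ℝ) ^ (m + L.sum))⁻¹ := by positivity
  linarith

end KraftWeight

section Incomparable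

/-- Neither string is a prefix of the other. -/
def Incomparable (σ ρ : BStr) : Prop := ¬ σ <+: ρ ∧ ¬ ρ <+: σ

lemma Incomparable.symm {σ ρ : BStr} (h : Incomparable σ ρ) : Incomparable ρ σ := ⟨h.2, h.1⟩

instance : Std.Symm Incomparable := ⟨fun _ _ => Incomparable.symm⟩

lemma Incomparable.mono_left {σ σ' ρ : BStr} (h : Incomparable σ ρ) (hσ : σ <+: σ') :
    Incomparable σ' ρ :=
  ⟨fun h' => h.1 (hσ.trans h'), fun h' => (List.prefix_or_prefix_of_prefix hσ h').elim h.1 h.2⟩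

lemma incomparable_append_bit (σ : BStr) :
    Incomparable (σ ++ [false]) (σ ++ [true]) := by
  constructor <;> simp [List.prefix_append_right_inj]

/-- Kraft's inequality for the extensions of a string. -/
lemma kcWeight_le_of_pairwise_incomparable (n : ℕ) : ∀ (τ : BStr) (S : List BStr),
    S.Pairwise Incomparable → (∀ σ ∈ S, τ <+: σ ∧ σ.length ≤ τ.length + n) →
      kcWeight (S.map List.length) ≤ ((2 : ℝ) ^ τ.length)⁻¹ := by
  have root (τ : BStr) (S : List BStr) (hp : S.Pairwise Incomparable)
      (hS : ∀ σ ∈ S, τ <+: σ) (hτ : τ ∈ S) :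
      kcWeight (S.map List.length) ≤ ((2 : ℝ) ^ τ.length)⁻¹ := by
    obtain ⟨A, B, rfl⟩ := List.append_of_mem hτ
    rw [List.pairwise_append, List.pairwise_cons] at hp
    have hA : A = [] := List.eq_nil_iff_forall_not_mem.2 fun σ hσ =>
      (hp.2.2 σ hσ τ (by simp)).2 (hS σ (by simp [hσ]))
    have hB : B = [] := List.eq_nil_iff_forall_not_mem.2 fun σ hσ =>
      (hp.2.1.1 σ hσ).1 (hS σ (by simp [hσ]))
    simp [hA, hB, kcWeight]
  induction n with
  | zero =>
    intro τ S hp hS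
    rcases S.eq_nil_or_concat with rfl | ⟨S', σ, rfl⟩
    · simp [kcWeight]
    · refine root τ _ hp (fun σ hσ => (hS σ hσ).1) ?_
      have h := hS σ (by simp)
      rw [h.1.eq_of_length_le (by simpa using h.2)]
      simp
  | succ n ih =>
    intro τ S hp hS
    by_cases hτ : τ ∈ S
    · exact root τ S hp (fun σ hσ => (hS σ hσ).1) hτ
    have hperm := (List.filter_append_perm (fun σ => decide ((τ ++ [false]) <+: σ)) S).map
      List.length
    rw [← kcWeight_perm hperm, List.map_append, kcWeight_append, ← inv_two_pow_succ]
    refine add_le_add ?_ ?_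
    · have h := ih (τ ++ [false]) _ (hp.filter fun σ => decide ((τ ++ [false]) <+: σ)) ?_
      · simpa using h
      · intro σ hσ
        simp only [List.mem_filter, decide_eq_true_eq] at hσ
        have := (hS σ hσ.1).2
        exact ⟨hσ.2, by simp; omega⟩
    · have h := ih (τ ++ [true]) _ (hp.filter fun σ => !decide ((τ ++ [false]) <+: σ)) ?_
      · simpa using h
      · intro σ hσ
        simp only [List.mem_filter, Bool.not_eq_true', decide_eq_false_iff_not] at hσ
        obtain ⟨⟨ρ, rfl⟩, hl⟩ := hS σ hσ.1
        refine ⟨?_, by simp at hl ⊢; omega⟩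
        have hσ2 := hσ.2
        rw [List.prefix_append_right_inj] at hσ2 ⊢
        match ρ, hσ, hσ2 with
        | [], hσ, _ => exact absurd (by simpa using hσ.1) hτ
        | false :: ρ, _, hσ2 => simp at hσ2
        | true :: ρ, _, _ => simp

end Incomparable

section Split

/-- The strings `μ 0^j 1` for `j < k`, longest first. -/
def splitOff (μ : BStr) (k : ℕ) : List BStr :=
  k.rec [] fun j S => (μ ++ List.replicate j false ++ [true]) :: S

lemma splitOff_succ (μ : BStr) (k : ℕ) :
    splitOff μ (k + 1) = (μ ++ List.replicate k false ++ [true]) :: splitOff μ k := rfl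

lemma prefix_of_mem_splitOff {μ σ : BStr} {k : ℕ} (h : σ ∈ splitOff μ k) : μ <+: σ := by
  induction k with
  | zero => simp [splitOff] at h
  | succ k ih =>
    rw [splitOff_succ, List.mem_cons] at h
    rcases h with rfl | h
    · simp [List.append_assoc]
    · exact ih h

lemma length_of_mem_splitOff {μ σ : BStr} {k : ℕ} (h : σ ∈ splitOff μ k) :
    μ.length < σ.length ∧ σ.length ≤ μ.length + k := by
  induction k with
  | zero => simp [splitOff] at h
  | succ k ih =>
    rw [splitOff_succ, List.mem_cons] at h
    rcases h with rfl | h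
    · simp
    · have := ih h
      omega

lemma splitOff_pairwise_length (μ : BStr) (k : ℕ) :
    (splitOff μ k).Pairwise (fun σ ρ => σ.length > ρ.length) := by
  induction k with
  | zero => simp [splitOff]
  | succ k ih =>
    rw [splitOff_succ, List.pairwise_cons]
    refine ⟨fun σ hσ => ?_, ih⟩
    have := length_of_mem_splitOff hσ
    simp; omega

lemma splitOff_pairwise_incomparable (μ : BStr) (k : ℕ) :
    ((μ ++ List.replicate k false) :: splitOff μ k).Pairwise Incomparable := by
  induction k with
  | zero => simp [splitOff]
  | succ k ih =>
    rw [List.pairwise_cons] at ih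
    rw [splitOff_succ, List.replicate_succ', ← List.append_assoc, List.pairwise_cons,
      List.pairwise_cons]
    refine ⟨?_, fun σ hσ => (ih.1 σ hσ).mono_left (List.prefix_append _ _), ih.2⟩
    simp only [List.forall_mem_cons]
    exact ⟨incomparable_append_bit _, fun σ hσ => (ih.1 σ hσ).mono_left (List.prefix_append _ _)⟩

lemma kcWeight_splitOff (μ : BStr) (k : ℕ) :
    ((2 : ℝ) ^ (μ.length + k))⁻¹ + kcWeight ((splitOff μ k).map List.length) =
      ((2 : ℝ) ^ μ.length)⁻¹ := by
  induction k with
  | zero => simp [splitOff, kcWeight]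
  | succ k ih =>
    rw [splitOff_succ, List.map_cons, kcWeight_cons, ← ih, ← inv_two_pow_succ (μ.length + k)]
    simp [add_assoc]

end Split

section Greedy

/-- One step of the greedy algorithm. The state consists of the free strings, longest first, and
the strings allocated so far; the request is served from the longest free string that fits. -/
def kcStep (s : List BStr × List BStr) (l : ℕ) : List BStr × List BStr :=
  let fit := s.1.filter fun μ => μ.length ≤ l
  (s.1.filter (fun μ => l < μ.length) ++ (splitOff fit.headI (l - fit.headI.length) ++ fit.tail),
    s.2 ++ [fit.headI ++ List.replicate (l - fit.headI.length) false])

/-- The state reached by the greedy algorithm after serving the requests `L`. -/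
def kcRun (τ : BStr) (L : List ℕ) : List BStr × List BStr :=
  L.foldl kcStep ([τ], [])

lemma prefix_foldl_kcStep (L : List ℕ) (s : List BStr × List BStr) :
    s.2 <+: (L.foldl kcStep s).2 := by
  induction L generalizing s with
  | nil => simp
  | cons l L ih => exact (List.prefix_append _ _).trans (ih (kcStep s l))

lemma kcRun_take_prefix_kcRun (τ : BStr) (L : List ℕ) (n : ℕ) :
    (kcRun τ (L.take n)).2 <+: (kcRun τ L).2 := by
  conv_rhs => rw [← List.take_append_drop n L, kcRun, List.foldl_append]
  exact prefix_foldl_kcStep _ _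

lemma primrec_replicate_false : Primrec fun n : ℕ => List.replicate n false :=
  (Primrec.nat_rec₁ [] (Primrec.list_cons.comp (Primrec.const false) Primrec.snd).to₂).of_eq
    fun n => by induction n with
      | zero => rfl
      | succ n ih => rw [List.replicate_succ, ← ih]

lemma primrec_splitOff : Primrec₂ splitOff := by
  refine Primrec.nat_rec (f := fun _ : BStr => ([] : List BStr))
    (g := fun μ (p : ℕ × List BStr) => (μ ++ List.replicate p.1 false ++ [true]) :: p.2)
    (Primrec.const _) ?_
  refine Primrec.list_cons.comp ?_ (Primrec.snd.comp Primrec.snd)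
  exact Primrec.list_append.comp (Primrec.list_append.comp Primrec.fst
    (primrec_replicate_false.comp (Primrec.fst.comp Primrec.snd))) (Primrec.const _)

lemma primrec_kcStep : Primrec₂ kcStep := by
  have hrel : PrimrecRel fun (μ : BStr) (l : ℕ) => μ.length ≤ l :=
    Primrec.nat_le.comp (Primrec.list_length.comp Primrec.fst) Primrec.snd
  have hrel' : PrimrecRel fun (μ : BStr) (l : ℕ) => l < μ.length :=
    Primrec.nat_lt.comp Primrec.snd (Primrec.list_length.comp Primrec.fst)
  have hfree : Primrec fun p : (List BStr × List BStr) × ℕ => p.1.1 :=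
    Primrec.fst.comp Primrec.fst
  have hfit := hrel.listFilter.comp hfree Primrec.snd
  have hlong := hrel'.listFilter.comp hfree Primrec.snd
  have hhead := Primrec.list_headI.comp hfit
  have hgap := Primrec.nat_sub.comp Primrec.snd (Primrec.list_length.comp hhead)
  exact Primrec.pair
    (Primrec.list_append.comp hlong
      (Primrec.list_append.comp (primrec_splitOff.comp hhead hgap) (Primrec.list_tail.comp hfit)))
    (Primrec.list_append.comp (Primrec.snd.comp Primrec.fst)
      (Primrec.list_cons.comp
        (Primrec.list_append.comp hhead (primrec_replicate_false.comp hgap)) (Primrec.const [])))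

lemma primrec_kcRun (τ : BStr) : Primrec (kcRun τ) :=
  Primrec.list_foldl Primrec.id (Primrec.const _)
    (primrec_kcStep.comp (Primrec.fst.comp Primrec.snd) (Primrec.snd.comp Primrec.snd)).to₂

/-- The invariant of the greedy algorithm. -/
structure KCInvariant (τ : BStr) (L : List ℕ) (s : List BStr × List BStr) : Prop where
  decreasing : s.1.Pairwise fun σ ρ => σ.length > ρ.length
  incomparable : (s.1 ++ s.2).Pairwise Incomparable
  extends_root : ∀ σ ∈ s.1 ++ s.2, τ <+: σ
  lengths : s.2.map List.length = L
  weight : kcWeight (s.1.map List.length) + kcWeight L = ((2 : ℝ) ^ τ.length)⁻¹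

lemma KCInvariant.exists_free {τ : BStr} {L : List ℕ} {s : List BStr × List BStr}
    (h : KCInvariant τ L s) {m : ℕ}
    (hm : kcWeight L ≤ ((2 : ℝ) ^ τ.length)⁻¹ - ((2 : ℝ) ^ m)⁻¹) :
    ∃ μ ∈ s.1, μ.length ≤ m := by
  by_contra! hlong
  have := kcWeight_lt_of_pairwise_gt (m := m) (List.pairwise_map.2 h.decreasing)
    (by simpa using hlong)
  linarith [h.weight]

lemma KCInvariant.kcStep {τ : BStr} {L : List ℕ} {s : List BStr × List BStr}
    (h : KCInvariant τ L s) {l : ℕ}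
    (hl : kcWeight L ≤ ((2 : ℝ) ^ τ.length)⁻¹ - ((2 : ℝ) ^ l)⁻¹) :
    KCInvariant τ (L ++ [l]) (kcStep s l) := by
  obtain ⟨F, out⟩ := s
  obtain ⟨μ₀, hμ₀, hμ₀l⟩ := h.exists_free hl
  obtain ⟨μ, B, hfit⟩ : ∃ μ B, F.filter (fun μ => decide (μ.length ≤ l)) = μ :: B :=
    List.exists_cons_of_ne_nil (List.ne_nil_of_mem (List.mem_filter.2 ⟨hμ₀, by simpa using hμ₀l⟩))
  set A := F.filter (fun μ => decide (l < μ.length)) with hA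
  have hstep : _root_.kcStep (F, out) l =
      (A ++ (splitOff μ (l - μ.length) ++ B),
        out ++ [μ ++ List.replicate (l - μ.length) false]) := by
    simp [_root_.kcStep, hfit, hA]
  have hperm : (A ++ μ :: B).Perm F := by
    rw [hA, ← hfit]
    have := List.filter_append_perm (fun μ : BStr => decide (l < μ.length)) F
    simpa [← decide_not, not_lt] using this
  obtain ⟨hdec, hinc, hext, hlen, hw⟩ := h
  have hμl : μ.length ≤ l := by
    have : μ ∈ F.filter (fun μ => decide (μ.length ≤ l)) := by simp [hfit]
    simpa using (List.mem_filter.1 this).2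
  have hAl : ∀ σ ∈ A, l < σ.length := fun σ hσ => by simpa using (List.mem_filter.1 hσ).2
  have hdecfit : (μ :: B).Pairwise fun σ ρ => σ.length > ρ.length := hfit ▸ hdec.filter _
  rw [List.pairwise_cons] at hdecfit
  obtain ⟨k, rfl⟩ := Nat.exists_eq_add_of_le hμl
  simp only [Nat.add_sub_cancel_left] at hstep
  rw [hstep]
  refine ⟨?_, ?_, ?_, ?_, ?_⟩
  · simp only [List.pairwise_append, List.mem_append]
    refine ⟨hdec.filter _, ⟨splitOff_pairwise_length _ _, hdecfit.2, fun σ hσ ρ hρ => ?_⟩,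
      fun σ hσ ρ hρ => ?_⟩
    · have := length_of_mem_splitOff hσ
      have := hdecfit.1 ρ hρ
      omega
    · have := hAl σ hσ
      rcases hρ with hρ | hρ
      · have := length_of_mem_splitOff hρ
        omega
      · have := hdecfit.1 ρ hρ
        omega
  · have hsymm : ∀ {σ ρ : BStr}, Incomparable σ ρ → Incomparable ρ σ := Incomparable.symm
    have hreq : (A ++ (splitOff μ k ++ B) ++ (out ++ [μ ++ List.replicate k false])).Perm
        (((μ ++ List.replicate k false) :: splitOff μ k) ++ (A ++ B ++ out)) := by
      rw [List.perm_iff_count]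
      intro σ
      simp only [List.count_append, List.count_cons, List.count_nil]
      omega
    have hold : (F ++ out).Perm (μ :: (A ++ B ++ out)) := by
      rw [List.perm_iff_count]
      intro σ
      have := (List.perm_iff_count.1 hperm) σ
      simp only [List.count_append, List.count_cons] at this ⊢
      omega
    rw [hreq.pairwise_iff hsymm, List.pairwise_append]
    rw [hold.pairwise_iff hsymm, List.pairwise_cons] at hinc
    refine ⟨splitOff_pairwise_incomparable _ _, hinc.2, fun σ hσ ρ hρ => ?_⟩
    refine (hinc.1 ρ hρ).mono_left ?_
    rcases List.mem_cons.1 hσ with rfl | hσ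
    · exact List.prefix_append _ _
    · exact prefix_of_mem_splitOff hσ
  · have hF : ∀ σ ∈ A ++ μ :: B, τ <+: σ := fun σ hσ =>
      hext σ (List.mem_append_left _ (hperm.mem_iff.1 hσ))
    have hμ : τ <+: μ := hF μ (by simp)
    intro σ hσ
    simp only [List.mem_append, List.mem_singleton] at hσ
    rcases hσ with (hσ | hσ | hσ) | hσ | rfl
    · exact hF σ (by simp [hσ])
    · exact hμ.trans (prefix_of_mem_splitOff hσ)
    · exact hF σ (by simp [hσ])
    · exact hext σ (by simp [hσ])
    · exact hμ.trans (List.prefix_append _ _)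
  · simp_all
  · have h1 := kcWeight_splitOff μ k
    have h2 := kcWeight_perm (hperm.map List.length)
    simp only [List.map_append, List.map_cons, kcWeight_append, kcWeight_cons, kcWeight_nil]
      at h2 hw ⊢
    linarith

lemma kcInvariant_kcRun (τ : BStr) (L : List ℕ) (hL : kcWeight L ≤ ((2 : ℝ) ^ τ.length)⁻¹) :
    KCInvariant τ L (kcRun τ L) := by
  induction L using List.reverseRecOn with
  | nil => constructor <;> simp [kcRun, kcWeight]
  | append_singleton L l ih =>
    rw [kcWeight_append, kcWeight_cons, kcWeight_nil] at hL
    have hpos : (0 : ℝ) < ((2 : ℝ) ^ l)⁻¹ := by positivity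
    rw [kcRun, List.foldl_append]
    exact (ih (by linarith)).kcStep (by linarith)

lemma KCInvariant.exists_incomparable_iff {τ : BStr} {L : List ℕ} {s : List BStr × List BStr}
    (h : KCInvariant τ L s) (m : ℕ) :
    (∃ ρ : BStr, τ <+: ρ ∧ ρ.length = m ∧ ∀ σ ∈ s.2, ¬ σ <+: ρ ∧ ¬ ρ <+: σ) ↔
      kcWeight L ≤ ((2 : ℝ) ^ τ.length)⁻¹ - ((2 : ℝ) ^ m)⁻¹ := by
  have hinc := List.pairwise_append.1 h.incomparable
  constructor
  · rintro ⟨ρ, hρ, rfl, hfree⟩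
    have hk := kcWeight_le_of_pairwise_incomparable (((ρ :: s.2).map List.length).sum) τ
      (ρ :: s.2) (List.pairwise_cons.2 ⟨fun σ hσ => (hfree σ hσ).symm, hinc.2.1⟩)
      fun σ hσ => ⟨?_, (List.le_sum_of_mem (List.mem_map_of_mem hσ)).trans (by omega)⟩
    · rw [List.map_cons, kcWeight_cons, h.lengths] at hk
      linarith
    · rcases List.mem_cons.1 hσ with rfl | hσ
      · exact hρ
      · exact h.extends_root σ (List.mem_append_right _ hσ)
  · intro hm
    obtain ⟨μ, hμ, hμm⟩ := h.exists_free hm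
    have hpre : μ <+: μ ++ List.replicate (m - μ.length) false := List.prefix_append _ _
    exact ⟨_, (h.extends_root μ (List.mem_append_left _ hμ)).trans hpre, by simp; omega,
      fun σ hσ => ((hinc.2.2 μ hμ σ hσ).mono_left hpre).symm⟩

end Greedy

/-- The greedy Kraft-Chaitin algorithm: a computable map from finite KC-sequences
relative to `τ` (of weight at most `2^{-|τ|}`) to solutions, which is monotone under
taking initial segments, and which leaves a clear extension of `τ` of length `ℓ` free
exactly when the weight is at most `2^{-|τ|} - 2^{-ℓ}`. -/
theorem stmt8 (τ : BStr) :
    ∃ G : List ℕ → List BStr, Computable G ∧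
      ∀ L : List ℕ, (∀ l ∈ L, 0 < l) → kcWeight L ≤ ((2 : ℝ) ^ τ.length)⁻¹ →
        -- (i) `G L` is a solution to `L` as a KC-sequence relative to `τ`
        ((G L).length = L.length ∧
          (∀ i, i < L.length →
            τ <+: (G L).getD i [] ∧ ((G L).getD i []).length = L.getD i 0) ∧
          (∀ i, i < L.length → ∀ j, j < L.length → i ≠ j →
            (G L).getD i [] ≠ (G L).getD j []) ∧
          PrefixFreeSet {σ | σ ∈ G L}) ∧
        -- (ii) monotonicity under initial segments
        (∀ s, s ≤ L.length → G (L.take s) <+: G L) ∧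
        -- (iii) clear extensions of `τ` of length `m` exist iff the weight bound holds
        (∀ m : ℕ,
          (∃ ρ : BStr, τ <+: ρ ∧ ρ.length = m ∧
              ∀ σ ∈ G L, ¬ σ <+: ρ ∧ ¬ ρ <+: σ) ↔
            kcWeight L ≤ ((2 : ℝ) ^ τ.length)⁻¹ - ((2 : ℝ) ^ m)⁻¹) := by
  refine ⟨fun L => (kcRun τ L).2, (Primrec.snd.comp (primrec_kcRun τ)).to_comp, fun L _ hL => ?_⟩
  have h := kcInvariant_kcRun τ L hL
  have hinc := (List.pairwise_append.1 h.incomparable).2.1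
  have hlen : (kcRun τ L).2.length = L.length := by
    simpa using congrArg List.length h.lengths
  refine ⟨⟨hlen, fun i hi => ?_, fun i hi j hj hij => ?_, fun σ hσ ρ hρ hpre => ?_⟩,
    fun n _ => kcRun_take_prefix_kcRun τ L n, h.exists_incomparable_iff⟩
  · have hi' : i < (kcRun τ L).2.length := hlen ▸ hi
    rw [List.getD_eq_getElem _ _ hi', List.getD_eq_getElem _ _ hi]
    refine ⟨h.extends_root _ (List.mem_append_right _ (List.getElem_mem hi')), ?_⟩
    exact (List.getElem_map List.length).symm.trans
      (List.getElem_of_eq h.lengths (by simpa using hi'))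
  · have hi' : i < (kcRun τ L).2.length := hlen ▸ hi
    have hj' : j < (kcRun τ L).2.length := hlen ▸ hj
    rw [List.getD_eq_getElem _ _ hi', List.getD_eq_getElem _ _ hj']
    have hnodup : (kcRun τ L).2.Nodup :=
      hinc.imp (by rintro σ _ hσ rfl; exact hσ.1 (List.prefix_refl _))
    exact fun heq => hij ((hnodup.getElem_inj_iff).1 heq)
  · by_contra hne
    exact (hinc.forall hσ hρ hne).1 hpre
end

section
/- Let X be a binary stream and let g : ℕ → ℕ be a computable function such that K(X↾n) ≤ g(n) for all n. Then there exists a partial computable function I from binary strings to ℕ such that ∑_{σ : I(σ) is defined} 2^{−I(σ)} ≤ 1 and I(X↾n) = g(n) for every n. -/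
open scoped ENNReal

/-- The first `n` bits of the stream `X`, as a binary string. -/
def stake (X : ℕ → Bool) (n : ℕ) : BStr := (List.range n).map X

/-- `X` is computable from `Y` with oracle-use `f`. -/
def ComputableWithUse (X Y : ℕ → Bool) (f : ℕ → ℕ) : Prop :=
  ∃ F : ℕ × BStr →. BStr, Partrec F ∧ ∀ n, stake X n ∈ F (n, stake Y (f n))

/-- A prefix-free machine: partial computable with prefix-free domain. -/
def PrefixFreeMachine (M : BStr →. BStr) : Prop :=
  Partrec M ∧ PrefixFreeSet {ρ | (M ρ).Dom}

/-- `K_M σ`: least length of an `M`-description of `σ` (`⊤` if none). -/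
noncomputable def KM (M : BStr →. BStr) (σ : BStr) : ℕ∞ :=
  sInf ((fun ρ : BStr => (ρ.length : ℕ∞)) '' {ρ | σ ∈ M ρ})

/-- Universal prefix-free machine. -/
def UniversalPFM (U : BStr →. BStr) : Prop :=
  PrefixFreeMachine U ∧
    ∀ M : BStr →. BStr, PrefixFreeMachine M →
      ∃ c : ℕ, ∀ σ, KM U σ ≤ KM M σ + (c : ℕ∞)

/-- Prefix-free Kolmogorov complexity w.r.t. `U`, as a natural number. -/
noncomputable def Kof (U : BStr →. BStr) (σ : BStr) : ℕ := (KM U σ).toNat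

/-- Martin-Löf randomness via Schnorr's characterization: `K(Y↾n) ≥ n - c`. -/
def MLRandom (U : BStr →. BStr) (Y : ℕ → Bool) : Prop :=
  ∃ c : ℕ, ∀ n, n ≤ Kof U (stake Y n) + c

/-- The weight `2^{-I(σ)}` contributed by `σ` (zero if `I σ` is undefined). -/
noncomputable def iweight (I : BStr →. ℕ) (σ : BStr) : ℝ≥0∞ :=
  haveI := Classical.propDecidable (I σ).Dom
  if h : (I σ).Dom then ((2 : ℝ≥0∞) ^ ((I σ).get h))⁻¹ else 0

open Nat.Partrec (Code)

theorem PrefixFreeSet.uniquelyDecodable {S : Set BStr} (hS : PrefixFreeSet S) (hnil : [] ∉ S) :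
    InformationTheory.UniquelyDecodable S := by
  intro L₁
  induction L₁ with
  | nil =>
    rintro (_ | ⟨b, L₂⟩) - h₂ h
    · rfl
    · have hb : b = [] := by simp_all
      exact absurd (hb ▸ h₂ b (by simp)) hnil
  | cons a L₁ ih =>
    rintro (_ | ⟨b, L₂⟩) h₁ h₂ h
    · have ha : a = [] := by simp_all
      exact absurd (ha ▸ h₁ a (by simp)) hnil
    · have ha := h₁ a (by simp)
      have hb := h₂ b (by simp)
      simp only [List.flatten_cons] at h
      have hab : a = b := by
        rcases List.prefix_or_prefix_of_prefix (List.prefix_append a L₁.flatten)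
          (h ▸ List.prefix_append b L₂.flatten) with h' | h'
        · exact hS a ha b hb h'
        · exact (hS b hb a ha h').symm
      subst hab
      rw [ih L₂ (fun w hw => h₁ w (by simp [hw])) (fun w hw => h₂ w (by simp [hw]))
        (List.append_cancel_left h)]

/-- Kraft's inequality for finite prefix-free sets of binary strings. -/
theorem PrefixFreeSet.sum_inv_two_pow_length_le_one {S : Finset BStr}
    (hS : PrefixFreeSet (S : Set BStr)) :
    ∑ ρ ∈ S, ((2 : ℝ≥0∞) ^ ρ.length)⁻¹ ≤ 1 := by
  by_cases hnil : [] ∈ S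
  · have : S = {[]} := by
      ext ρ
      rw [Finset.mem_singleton]
      refine ⟨fun h => (hS [] hnil ρ h (List.nil_prefix)).symm, fun h => h ▸ hnil⟩
    simp [this]
  · have h := InformationTheory.kraft_mcmillan_inequality
      (hS.uniquelyDecodable (by simpa using hnil))
    have hterm (ρ : BStr) :
        ((2 : ℝ≥0∞) ^ ρ.length)⁻¹ = ENNReal.ofReal ((1 / Fintype.card Bool : ℝ) ^ ρ.length) := by
      rw [ENNReal.ofReal_pow (by positivity), ENNReal.inv_pow]
      simp [ENNReal.ofReal_inv_of_pos]
    simp_rw [hterm]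
    rw [← ENNReal.ofReal_sum_of_nonneg (fun _ _ => by positivity)]
    exact ENNReal.ofReal_le_one.2 h

/-- A computable function can be restricted to the strings `σ` that have a description of length
at most its value at `σ`. -/
theorem exists_partrec_restrict_described {M : BStr →. BStr} (hM : Partrec M) {b : BStr → ℕ}
    (hb : Computable b) :
    ∃ I : BStr →. ℕ, Partrec I ∧
      ∀ σ n, n ∈ I σ ↔ n = b σ ∧ ∃ ρ, σ ∈ M ρ ∧ ρ.length ≤ b σ := by
  obtain ⟨c, hc⟩ := Code.exists_code.1 hM
  have hc' (σ ρ : BStr) :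
      σ ∈ M ρ ↔ ∃ k, Encodable.encode σ ∈ Code.evaln k c (Encodable.encode ρ) := by
    rw [← Code.evaln_complete, hc]
    simp
  let test (σ : BStr) (p : ℕ × BStr) : Bool :=
    decide (Code.evaln p.1 c (Encodable.encode p.2) = some (Encodable.encode σ)) &&
      decide (p.2.length ≤ b σ)
  have htest : Computable₂ test := by
    refine Primrec.and.to_comp.comp ?_ ?_
    · exact Primrec.eq.decide.to_comp.comp
        (Code.primrec_evaln.to_comp.comp
          (((Computable.fst.comp Computable.snd).pair (Computable.const c)).pair
            (Computable.encode.comp (Computable.snd.comp Computable.snd))))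
        (Computable.option_some.comp (Computable.encode.comp Computable.fst))
    · exact Primrec.nat_le.decide.to_comp.comp
        (Computable.list_length.comp (Computable.snd.comp Computable.snd))
        (hb.comp Computable.fst)
  let f (σ : BStr) (k : ℕ) : Option ℕ :=
    (Encodable.decode (α := ℕ × BStr) k).bind fun p => bif test σ p then some (b σ) else none
  have hf : Computable₂ f := by
    refine Computable.option_bind (Computable.decode.comp Computable.snd) ?_
    exact Computable.cond
      (htest.comp (Computable.fst.comp Computable.fst) Computable.snd)
      (Computable.option_some.comp (hb.comp (Computable.fst.comp Computable.fst)))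
      (Computable.const none)
  have hmem (σ : BStr) (n k : ℕ) : n ∈ f σ k ↔
      ∃ p : ℕ × BStr, Encodable.decode k = some p ∧ test σ p = true ∧ n = b σ := by
    simp only [f, Option.mem_def, Option.bind_eq_some_iff]
    refine exists_congr fun p => and_congr_right fun _ => ?_
    cases test σ p <;> simp [eq_comm]
  refine ⟨fun σ => Nat.rfindOpt (f σ), Partrec.rfindOpt hf, fun σ n => ⟨fun h => ?_, ?_⟩⟩
  · obtain ⟨k, hk⟩ := Nat.rfindOpt_spec h
    obtain ⟨p, -, hp, rfl⟩ := (hmem σ n k).1 hk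
    simp only [test, Bool.and_eq_true, decide_eq_true_eq] at hp
    exact ⟨rfl, p.2, (hc' σ p.2).2 ⟨p.1, hp.1⟩, hp.2⟩
  · rintro ⟨rfl, ρ, hρ, hlen⟩
    obtain ⟨k, hk⟩ := (hc' σ ρ).1 hρ
    have hdom : (Nat.rfindOpt (f σ)).Dom :=
      Nat.rfindOpt_dom.2 ⟨Encodable.encode (k, ρ), b σ, (hmem _ _ _).2
        ⟨(k, ρ), Encodable.encodek _, by simpa [test, hlen] using hk, rfl⟩⟩
    obtain ⟨j, hj⟩ := Nat.rfindOpt_spec (Part.get_mem hdom)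
    obtain ⟨-, -, -, h⟩ := (hmem _ _ _).1 hj
    exact h ▸ Part.get_mem hdom

theorem UniversalPFM.KM_ne_top {U : BStr →. BStr} (hU : UniversalPFM U) (σ : BStr) :
    KM U σ ≠ ⊤ := by
  let M : BStr →. BStr := fun ρ => ((bif decide (ρ = []) then some σ else none : Option BStr))
  have hM : PrefixFreeMachine M := by
    constructor
    · exact Computable.ofOption (Computable.cond
        (Primrec.eq.decide.to_comp.comp Computable.id (Computable.const []))
        (Computable.const (some σ)) (Computable.const none))
    · have hnil (ρ : BStr) (h : (M ρ).Dom) : ρ = [] := by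
        by_contra hρ
        simp [M, hρ] at h
      intro ρ hρ τ hτ _
      rw [hnil ρ hρ, hnil τ hτ]
  obtain ⟨c, hc⟩ := hU.2 M hM
  have hKM : KM M σ ≤ 0 := sInf_le ⟨[], by simp [M], by simp⟩
  exact ne_top_of_le_ne_top (by simp) ((hc σ).trans (add_le_add_left hKM _))

theorem UniversalPFM.exists_length_eq_Kof {U : BStr →. BStr} (hU : UniversalPFM U) (σ : BStr) :
    ∃ ρ, σ ∈ U ρ ∧ ρ.length = Kof U σ := by
  have hne : ((fun ρ : BStr => (ρ.length : ℕ∞)) '' {ρ | σ ∈ U ρ}).Nonempty := by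
    by_contra h
    exact hU.KM_ne_top σ (by simp [KM, Set.not_nonempty_iff_eq_empty.1 h])
  obtain ⟨ρ, hρ, h⟩ := csInf_mem hne
  refine ⟨ρ, hρ, ?_⟩
  rw [Kof, KM, ← h]
  simp

theorem PrefixFreeMachine.tsum_iweight_le_one {M : BStr →. BStr} (hM : PrefixFreeMachine M)
    {I : BStr →. ℕ} (hI : ∀ σ, ∀ n ∈ I σ, ∃ ρ, σ ∈ M ρ ∧ ρ.length ≤ n) :
    ∑' σ, iweight I σ ≤ 1 := by
  classical
  have hex (σ : BStr) : ∃ ρ, ∀ n ∈ I σ, σ ∈ M ρ ∧ ρ.length ≤ n := by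
    by_cases h : (I σ).Dom
    · obtain ⟨ρ, hρ⟩ := hI σ _ (Part.get_mem h)
      exact ⟨ρ, fun n hn => Part.mem_unique hn (Part.get_mem h) ▸ hρ⟩
    · exact ⟨[], fun n hn => absurd hn.1 h⟩
  choose d hd using hex
  have hmem (σ : BStr) (h : (I σ).Dom) : σ ∈ M (d σ) := (hd σ _ (Part.get_mem h)).1
  rw [ENNReal.tsum_eq_iSup_sum]
  refine iSup_le fun s => ?_
  set t := s.filter fun σ => (I σ).Dom
  have ht (σ : BStr) (h : σ ∈ t) : (I σ).Dom := (Finset.mem_filter.1 h).2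
  have hinj : Set.InjOn d t := fun σ hσ τ hτ h =>
    Part.mem_unique (hmem σ (ht σ hσ)) (h ▸ hmem τ (ht τ hτ))
  have hpf : PrefixFreeSet ((t.image d : Finset BStr) : Set BStr) := by
    have hdom (ρ : BStr) (h : ρ ∈ t.image d) : (M ρ).Dom := by
      obtain ⟨σ, hσ, rfl⟩ := Finset.mem_image.1 h
      exact (hmem σ (ht σ hσ)).1
    exact fun ρ hρ τ hτ h => hM.2 ρ (hdom ρ hρ) τ (hdom τ hτ) h
  calc ∑ σ ∈ s, iweight I σ = ∑ σ ∈ t, iweight I σ := by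
        refine (Finset.sum_filter_of_ne fun σ _ h => ?_).symm
        by_contra hσ
        simp [iweight, hσ] at h
    _ ≤ ∑ σ ∈ t, ((2 : ℝ≥0∞) ^ (d σ).length)⁻¹ := by
        refine Finset.sum_le_sum fun σ hσ => ?_
        rw [iweight, dif_pos (ht σ hσ), ENNReal.inv_le_inv]
        exact pow_le_pow_right₀ (by norm_num) (hd σ _ (Part.get_mem (ht σ hσ))).2
    _ = ∑ ρ ∈ t.image d, ((2 : ℝ≥0∞) ^ ρ.length)⁻¹ := by
        rw [Finset.sum_image hinj]
    _ ≤ 1 := hpf.sum_inv_two_pow_length_le_one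

/-- If `g` is a computable upper bound on `n ↦ K(X↾n)`, then there is a partial
computable information content measure `I` with `I(X↾n) = g(n)` for all `n`. -/
theorem stmt14 (U : BStr →. BStr) (hU : UniversalPFM U)
    (X : ℕ → Bool) (g : ℕ → ℕ) (hg : Computable g)
    (hbound : ∀ n, Kof U (stake X n) ≤ g n) :
    ∃ I : BStr →. ℕ, Partrec I ∧ (∑' σ : BStr, iweight I σ) ≤ 1 ∧
      ∀ n, I (stake X n) = Part.some (g n) := by
  obtain ⟨I, hI, hmem⟩ := exists_partrec_restrict_described hU.1.1
    (hg.comp Computable.list_length)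
  refine ⟨I, hI, hU.1.tsum_iweight_le_one fun σ n hn => ?_, fun n => ?_⟩
  · obtain ⟨rfl, h⟩ := (hmem σ n).1 hn
    exact h
  · obtain ⟨ρ, hρ, hlen⟩ := hU.exists_length_eq_Kof (stake X n)
    have hn : (stake X n).length = n := by simp [stake]
    refine Part.eq_some_iff.2 ((hmem _ _).2 ⟨by rw [hn], ρ, hρ, ?_⟩)
    rw [hn, hlen]
    exact hbound n
end

section
/- Let X and Y be binary streams and let g : ℕ → ℕ. If X is computable from Y with oracle-use g, then for all but finitely many n, K(X↾n) < g(n) + 3·log₂ n, where log₂ denotes the real base-2 logarithm. (In particular, the oracle-use in any computation of a stream X from an oracle stream must, for almost all n, exceed K(X↾n) minus a quantity of order log n.) -/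
open scoped ENNReal

/-- The number whose binary expansion, most significant bit first, is the given string. -/
def binVal (l : BStr) : ℕ := l.foldl (fun a b => 2 * a + b.toNat) 0

theorem exists_binVal_eq (L : ℕ) : ∀ p < 2 ^ L, ∃ β : BStr, β.length = L ∧ binVal β = p := by
  induction L with
  | zero => intro p hp; exact ⟨[], rfl, by simp [binVal] at hp ⊢; omega⟩
  | succ L ih =>
    intro p hp
    obtain ⟨β, hl, hv⟩ := ih (p / 2) (by rw [pow_succ] at hp; omega)
    refine ⟨β ++ [decide (p % 2 = 1)], by simp [hl], ?_⟩
    unfold binVal at hv ⊢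
    rw [List.foldl_append, hv]
    rcases Nat.mod_two_eq_zero_or_one p with h | h <;> simp [h] <;> omega

theorem primrec_binVal : Primrec binVal := by
  have hb : Primrec Bool.toNat := Primrec.dom_finite _
  have h : Primrec₂ fun (_ : BStr) (x : ℕ × Bool) => 2 * x.1 + x.2.toNat :=
    (Primrec.nat_add.comp (Primrec.nat_double.comp (Primrec.fst.comp Primrec.snd))
      (hb.comp (Primrec.snd.comp Primrec.snd))).to₂
  exact Primrec.list_foldl Primrec.id (Primrec.const 0) h

/-- The number `k` of leading `true`s of a codeword. -/
def codeSize (ρ : BStr) : ℕ := ρ.idxOf false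

/-- The pair of numbers stored in the `4 * k` bits after the block `true ^ k false`. -/
def codeHeader (ρ : BStr) : ℕ × ℕ :=
  Nat.unpair (binVal ((ρ.drop (codeSize ρ + 1)).take (4 * codeSize ρ)))

/-- The part of a codeword after the header. -/
def codeBody (ρ : BStr) : BStr := ρ.drop (5 * codeSize ρ + 1)

/-- The second number of the header is the length of the body. -/
def codeValid (ρ : BStr) : Bool :=
  ρ.length == 5 * codeSize ρ + 1 + (codeHeader ρ).2

theorem primrec_codeSize : Primrec codeSize :=
  Primrec.list_idxOf.comp (Primrec.const false) Primrec.id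

theorem primrec_codeHeader : Primrec codeHeader :=
  Primrec.unpair.comp (primrec_binVal.comp (Primrec.list_take.comp
    (Primrec.nat_mul.comp (Primrec.const 4) primrec_codeSize)
    (Primrec.list_drop.comp (Primrec.succ.comp primrec_codeSize) Primrec.id)))

theorem primrec_codeBody : Primrec codeBody :=
  Primrec.list_drop.comp (Primrec.succ.comp
    (Primrec.nat_mul.comp (Primrec.const 5) primrec_codeSize)) Primrec.id

theorem primrec_codeValid : Primrec codeValid :=
  Primrec.beq.comp Primrec.list_length (Primrec.nat_add.comp (Primrec.succ.comp
    (Primrec.nat_mul.comp (Primrec.const 5) primrec_codeSize))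
    (Primrec.snd.comp primrec_codeHeader))

theorem prefixFreeSet_codeValid : PrefixFreeSet {ρ | codeValid ρ = true} := by
  rintro ρ hρ _ hτ ⟨t, rfl⟩
  simp only [Set.mem_ofPred_eq, codeValid, beq_iff_eq] at hρ hτ
  have hk : codeSize (ρ ++ t) = codeSize ρ :=
    List.idxOf_append_of_mem (List.idxOf_lt_length_iff.1 (by
      change codeSize ρ < ρ.length
      omega))
  have hh : codeHeader (ρ ++ t) = codeHeader ρ := by
    unfold codeHeader
    rw [hk, List.drop_append_of_le_length (by omega),
      List.take_append_of_le_length (by rw [List.length_drop]; omega)]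
  rw [hk, hh, ← hρ, List.length_append] at hτ
  have : t = [] := List.length_eq_zero_iff.1 (by omega)
  simp [this]

theorem exists_codeword {n k : ℕ} {σ : BStr} (h : Nat.pair n σ.length < 2 ^ (4 * k)) :
    ∃ ρ : BStr, codeValid ρ = true ∧ (codeHeader ρ).1 = n ∧ codeBody ρ = σ ∧
      ρ.length = 5 * k + 1 + σ.length := by
  obtain ⟨β, hl, hv⟩ := exists_binVal_eq _ _ h
  let ρ : BStr := List.replicate k true ++ false :: (β ++ σ)
  have hlen : ρ.length = 5 * k + 1 + σ.length := by simp [ρ, hl]; omega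
  have hk : codeSize ρ = k := by
    unfold codeSize
    rw [List.idxOf_append_of_notMem (by simp [List.mem_replicate])]
    simp
  have hd : ρ.drop (k + 1) = β ++ σ := by
    rw [← List.drop_drop, List.drop_left' (by simp)]
    rfl
  have hh : codeHeader ρ = (n, σ.length) := by
    unfold codeHeader
    rw [hk, hd, List.take_left' hl, hv, Nat.unpair_pair]
  have hb : codeBody ρ = σ := by
    unfold codeBody
    rw [hk, show 5 * k + 1 = (k + 1) + 4 * k by omega, ← List.drop_drop, hd, List.drop_left' hl]
  exact ⟨ρ, by simp [codeValid, hk, hh, hlen], by rw [hh], hb, hlen⟩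

/-- The prefix-free machine that decodes a codeword and applies `F` to its contents. -/
def codeMachine (F : ℕ × BStr →. BStr) : BStr →. BStr := fun ρ =>
  bif codeValid ρ then F ((codeHeader ρ).1, codeBody ρ) else Part.none

theorem prefixFreeMachine_codeMachine {F : ℕ × BStr →. BStr} (hF : Partrec F) :
    PrefixFreeMachine (codeMachine F) := by
  constructor
  · exact Partrec.cond primrec_codeValid.to_comp
      (hF.comp ((Primrec.fst.comp primrec_codeHeader).pair primrec_codeBody).to_comp)
      Partrec.none
  · have hv : ∀ ρ, (codeMachine F ρ).Dom → codeValid ρ = true := by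
      intro ρ h
      by_contra hc
      rw [codeMachine, Bool.not_eq_true _ |>.mp hc] at h
      exact h
    exact fun ρ hρ τ hτ h => prefixFreeSet_codeValid ρ (hv ρ hρ) τ (hv τ hτ) h

theorem UniversalPFM.exists_Kof_le {U M : BStr →. BStr} (hU : UniversalPFM U)
    (hM : PrefixFreeMachine M) : ∃ c, ∀ ρ, ∀ τ ∈ M ρ, Kof U τ ≤ ρ.length + c := by
  obtain ⟨c, hc⟩ := hU.2 M hM
  refine ⟨c, fun ρ τ h => ENat.toNat_le_of_le_natCast ((hc τ).trans ?_)⟩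
  push_cast
  gcongr
  exact sInf_le ⟨ρ, h, rfl⟩

/-- Applying a fixed partial computable function to `n` and a string of length at most `n`
raises complexity above length by at most `(5 / 2) * log₂ n + O(1)`. -/
theorem UniversalPFM.exists_Kof_le_log {U : BStr →. BStr} (hU : UniversalPFM U)
    {F : ℕ × BStr →. BStr} (hF : Partrec F) :
    ∃ c, ∀ n (σ τ : BStr), σ.length ≤ n → τ ∈ F (n, σ) →
      2 * Kof U τ ≤ 2 * σ.length + 5 * Nat.log 2 n + c := by
  obtain ⟨c, hc⟩ := hU.exists_Kof_le (prefixFreeMachine_codeMachine hF)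
  refine ⟨2 * c + 12, fun n σ τ hσ hτ => ?_⟩
  obtain ⟨ρ, hv, h1, hb, hl⟩ := exists_codeword (n := n) (k := (Nat.log 2 n + 2) / 2) (σ := σ) <| by
    calc Nat.pair n σ.length < (max n σ.length + 1) ^ 2 := Nat.pair_lt_max_add_one_sq _ _
      _ = (n + 1) ^ 2 := by rw [max_eq_left hσ]
      _ ≤ (2 ^ (Nat.log 2 n + 1)) ^ 2 :=
        Nat.pow_le_pow_left (Nat.lt_pow_succ_log_self one_lt_two n) 2
      _ = 2 ^ (2 * (Nat.log 2 n + 1)) := by rw [← pow_mul, mul_comm]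
      _ ≤ _ := Nat.pow_le_pow_right two_pos (by omega)
  have := hc ρ τ (by rw [codeMachine, hv, h1, hb]; exact hτ)
  omega

/-- If `X` is computable from `Y` with oracle-use `g`, then for all but finitely many
`n`, `K(X↾n) < g(n) + 3·log₂ n`. -/
theorem stmt15 (U : BStr →. BStr) (hU : UniversalPFM U)
    (X Y : ℕ → Bool) (g : ℕ → ℕ) (h : ComputableWithUse X Y g) :
    ∃ N : ℕ, ∀ n, N ≤ n →
      (Kof U (stake X n) : ℝ) < (g n : ℝ) + 3 * Real.logb 2 (n : ℝ) := by
  have length_stake : ∀ (Z : ℕ → Bool) n, (stake Z n).length = n := by simp [stake]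
  obtain ⟨F, hF, hX⟩ := h
  obtain ⟨c, hc⟩ := hU.exists_Kof_le_log hF
  obtain ⟨d, hd⟩ := hU.exists_Kof_le_log (F := fun x => Part.some x.2) Computable.snd
  refine ⟨2 ^ (c + d + 1), fun n hn => ?_⟩
  have hlog : c + d + 1 ≤ Nat.log 2 n := Nat.le_log_of_pow_le one_lt_two hn
  have key : Kof U (stake X n) < g n + 3 * Nat.log 2 n := by
    rcases le_total (g n) n with hg | hg
    · have := hc n (stake Y (g n)) (stake X n) (by rwa [length_stake]) (hX n)
      rw [length_stake] at this
      omega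
    · have := hd n (stake X n) (stake X n) (length_stake X n).le (Part.mem_some _)
      rw [length_stake] at this
      omega
  calc (Kof U (stake X n) : ℝ) < g n + 3 * Nat.log 2 n := by exact_mod_cast key
    _ ≤ _ := by
      gcongr
      exact_mod_cast Real.natLog_le_logb n 2
end
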